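/- arXiv:math/0507051 — 2 statements merged into one kernel-verified Lean document; each statement's English description precedes it below -/
import Mathlib

section
/- Let g = (1664357/25425)x + 2y + (203063/25425)y^2 - (135871/2825)yx + y^6 - 4y^3 + (18148/565)yx^5 - (34736/2825)yx^2 - (73177/25425)x^6 - 88819/25425 + 2y^5 - (5222126/25425)x^2 - (135871/2825)y^5x + (1664357/25425)y^4x + (6641603/25425)x^3 - (139669/25425)y^4 - (3903338/25425)x^4 - (4882462/25425)y^4x^2 + (39260/1017)x^5 + (271742/2825)y^3x - 193y^3x^3 - (3328714/25425)y^2x - (471008/2825)yx^4 + 193x^3y - (6641603/25425)y^2x^3 + (1122732/2825)y^2x^2 + (34736/2825)y^3x^2 - (337334/25425)y^2x^4, regarded as a polynomial in ℂ[x,y]. Then g is irreducible in ℂ[x,y], and there do not exist polynomials p, q ∈ ℂ[x,y] with total degree of p at most 2 and total degree of q at most 3 such that g = p^3 + q^2. -/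
open MvPolynomial

noncomputable section

def x : MvPolynomial (Fin 2) ℂ := X 0
def y : MvPolynomial (Fin 2) ℂ := X 1
def c (q : ℚ) : MvPolynomial (Fin 2) ℂ := C (q : ℂ)

/-- The sextic of non-torus type with configuration `[2A_5 + E_6]` (Method 1). -/
def g : MvPolynomial (Fin 2) ℂ :=
  c (1664357/25425) * x + 2 * y + c (203063/25425) * y ^ 2 - c (135871/2825) * y * x
    + y ^ 6 - 4 * y ^ 3 + c (18148/565) * y * x ^ 5 - c (34736/2825) * y * x ^ 2
    - c (73177/25425) * x ^ 6 - c (88819/25425) + 2 * y ^ 5 - c (5222126/25425) * x ^ 2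
    - c (135871/2825) * y ^ 5 * x + c (1664357/25425) * y ^ 4 * x
    + c (6641603/25425) * x ^ 3 - c (139669/25425) * y ^ 4 - c (3903338/25425) * x ^ 4
    - c (4882462/25425) * y ^ 4 * x ^ 2 + c (39260/1017) * x ^ 5
    + c (271742/2825) * y ^ 3 * x - 193 * y ^ 3 * x ^ 3 - c (3328714/25425) * y ^ 2 * x
    - c (471008/2825) * y * x ^ 4 + 193 * x ^ 3 * y - c (6641603/25425) * y ^ 2 * x ^ 3
    + c (1122732/2825) * y ^ 2 * x ^ 2 + c (34736/2825) * y ^ 3 * x ^ 2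
    - c (337334/25425) * y ^ 2 * x ^ 4

set_option linter.unusedSimpArgs false

def lx : Polynomial (Polynomial ℂ) := 1 - 413 * Polynomial.X - 63 * Polynomial.C Polynomial.X

def ly : Polynomial (Polynomial ℂ) := 367 * Polynomial.X + 41 * Polynomial.C Polynomial.X

def psi : MvPolynomial (Fin 2) ℂ →ₐ[ℂ] Polynomial (Polynomial ℂ) := aeval ![lx, ly]

def co (A : MvPolynomial (Fin 2) ℂ) (i j : ℕ) : ℂ := ((psi A).coeff i).coeff j

lemma co_mul (A B : MvPolynomial (Fin 2) ℂ) (i j : ℕ) :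
    co (A * B) i j = ∑ k ∈ Finset.HasAntidiagonal.antidiagonal i, ∑ l ∈ Finset.HasAntidiagonal.antidiagonal j,
      co A k.1 l.1 * co B k.2 l.2 := by
  simp [co, Polynomial.coeff_mul, Polynomial.finsetSum_coeff]

def Dg (n : ℕ) (F : Polynomial (Polynomial ℂ)) : Prop :=
  ∀ i j, n < i + j → (F.coeff i).coeff j = 0

lemma Dg.mul {m n : ℕ} {F G : Polynomial (Polynomial ℂ)} (hF : Dg m F) (hG : Dg n G) :
    Dg (m + n) (F * G) := by
  intro i j hij
  rw [Polynomial.coeff_mul, Polynomial.finsetSum_coeff]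
  refine Finset.sum_eq_zero fun k hk => ?_
  rw [Polynomial.coeff_mul]
  refine Finset.sum_eq_zero fun l hl => ?_
  rw [Finset.HasAntidiagonal.mem_antidiagonal] at hk hl
  by_cases h : m < k.1 + l.1
  · rw [hF _ _ h, zero_mul]
  · rw [hG k.2 l.2 (by omega), mul_zero]

lemma Dg.pow {m : ℕ} {F : Polynomial (Polynomial ℂ)} (hF : Dg m F) (k : ℕ) :
    Dg (k * m) (F ^ k) := by
  induction k with
  | zero =>
    intro i j hij
    rw [pow_zero, Polynomial.coeff_one]
    split_ifs with h
    · rw [Polynomial.coeff_one, if_neg (by omega)]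
    · simp
  | succ k ih =>
    rw [pow_succ, Nat.succ_mul]
    exact ih.mul hF

lemma dg_aux (r s t : ℂ) : Dg 1 (Polynomial.C (Polynomial.C r + Polynomial.C s * Polynomial.X)
    + Polynomial.C (Polynomial.C t) * Polynomial.X) := by
  intro i j hij
  rcases i with _ | _ | i
  · rcases j with _ | _ | j
    · omega
    · omega
    · simp [Polynomial.coeff_C, Polynomial.coeff_X]
  · rcases j with _ | j
    · omega
    · simp [Polynomial.coeff_C]
  · simp [Polynomial.coeff_C, Polynomial.coeff_X]

lemma dg_lx : Dg 1 lx := by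
  have := dg_aux 1 (-63) (-413)
  convert this using 1
  simp only [lx, map_neg, map_one, map_zero, map_ofNat, map_add, map_mul]; ring

lemma dg_ly : Dg 1 ly := by
  have := dg_aux 0 41 367
  convert this using 1
  simp only [ly, map_neg, map_one, map_zero, map_ofNat, map_add, map_mul]; ring

lemma co_deg (A : MvPolynomial (Fin 2) ℂ) (i j : ℕ) (h : A.totalDegree < i + j) :
    co A i j = 0 := by
  rw [co, psi, aeval_def, eval₂_eq', Polynomial.finsetSum_coeff, Polynomial.finsetSum_coeff]
  refine Finset.sum_eq_zero fun d hd => ?_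
  have h1 := le_totalDegree hd
  rw [Finsupp.sum_fintype _ _ (fun _ => rfl), Fin.sum_univ_two] at h1
  have h2 := ((dg_lx.pow (d 0)).mul (dg_ly.pow (d 1))) i j (by omega)
  rw [Fin.prod_univ_two]
  have e : (algebraMap ℂ (Polynomial (Polynomial ℂ))) (coeff d A)
    = Polynomial.C (Polynomial.C (coeff d A)) := rfl
  rw [e, Polynomial.coeff_C_mul, Polynomial.coeff_C_mul]
  simp only [Matrix.cons_val_zero, Matrix.cons_val_one]
  rw [h2, mul_zero]

lemma psi_x : psi x = lx := by simp [psi, x]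
lemma psi_y : psi y = ly := by simp [psi, y]

lemma g25425 : 25425 * g = 
  1664357 * x + 50850 * y + 203063 * y ^ 2 - 1222839 * y * x
    + 25425 * y ^ 6 - 101700 * y ^ 3 + 816660 * y * x ^ 5 - 312624 * y * x ^ 2
    - 73177 * x ^ 6 - 88819 + 50850 * y ^ 5 - 5222126 * x ^ 2
    - 1222839 * y ^ 5 * x + 1664357 * y ^ 4 * x
    + 6641603 * x ^ 3 - 139669 * y ^ 4 - 3903338 * x ^ 4
    - 4882462 * y ^ 4 * x ^ 2 + 981500 * x ^ 5
    + 2445678 * y ^ 3 * x - 4907025 * y ^ 3 * x ^ 3 - 3328714 * y ^ 2 * x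
    - 4239072 * y * x ^ 4 + 4907025 * x ^ 3 * y - 6641603 * y ^ 2 * x ^ 3
    + 10104588 * y ^ 2 * x ^ 2 + 312624 * y ^ 3 * x ^ 2
    - 337334 * y ^ 2 * x ^ 4 := by
  have k : ∀ (n : ℕ) (q : ℚ) (m : ℕ), (n : ℚ) * q = m →
      (n : MvPolynomial (Fin 2) ℂ) * c q = m := by
    intro n q m h
    have h' : (n : ℂ) * (q : ℂ) = m := by exact_mod_cast congrArg (fun z : ℚ => (z : ℂ)) h
    rw [c, ← map_natCast (C (σ := Fin 2) (R := ℂ)) n, ← map_mul, h', map_natCast]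
  have e1 := k 25425 (1664357/25425) 1664357 (by norm_num)
  have e2 := k 25425 (203063/25425) 203063 (by norm_num)
  have e3 := k 25425 (135871/2825) 1222839 (by norm_num)
  have e4 := k 25425 (18148/565) 816660 (by norm_num)
  have e5 := k 25425 (34736/2825) 312624 (by norm_num)
  have e6 := k 25425 (73177/25425) 73177 (by norm_num)
  have e7 := k 25425 (88819/25425) 88819 (by norm_num)
  have e8 := k 25425 (5222126/25425) 5222126 (by norm_num)
  have e9 := k 25425 (6641603/25425) 6641603 (by norm_num)
  have e10 := k 25425 (139669/25425) 139669 (by norm_num)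
  have e11 := k 25425 (3903338/25425) 3903338 (by norm_num)
  have e12 := k 25425 (4882462/25425) 4882462 (by norm_num)
  have e13 := k 25425 (39260/1017) 981500 (by norm_num)
  have e14 := k 25425 (271742/2825) 2445678 (by norm_num)
  have e15 := k 25425 (3328714/25425) 3328714 (by norm_num)
  have e16 := k 25425 (471008/2825) 4239072 (by norm_num)
  have e17 := k 25425 (1122732/2825) 10104588 (by norm_num)
  have e18 := k 25425 (337334/25425) 337334 (by norm_num)
  push_cast at e1 e2 e3 e4 e5 e6 e7 e8 e9 e10 e11 e12 e13 e14 e15 e16 e17 e18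
  rw [g]
  linear_combination (x + y ^ 4 * x) * e1 + y ^ 2 * e2 - (y * x + y ^ 5 * x) * e3
    + y * x ^ 5 * e4 + (- y * x ^ 2 + y ^ 3 * x ^ 2) * e5 - x ^ 6 * e6 - e7 - x ^ 2 * e8
    + (x ^ 3 - y ^ 2 * x ^ 3) * e9 - y ^ 4 * e10 - x ^ 4 * e11 - y ^ 4 * x ^ 2 * e12
    + x ^ 5 * e13 + y ^ 3 * x * e14 - y ^ 2 * x * e15 - y * x ^ 4 * e16
    + y ^ 2 * x ^ 2 * e17 - y ^ 2 * x ^ 4 * e18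

lemma psi_g : (25425 : Polynomial (Polynomial ℂ)) * psi g =
    (405579663216 * (Polynomial.C Polynomial.X : Polynomial (Polynomial ℂ)) ^ 4 + 84789050542560 * (Polynomial.C Polynomial.X : Polynomial (Polynomial ℂ)) ^ 5 + (-7885566899437968) * (Polynomial.C Polynomial.X : Polynomial (Polynomial ℂ)) ^ 6) * Polynomial.X ^ 0
    + (2497201442570016 * (Polynomial.C Polynomial.X : Polynomial (Polynomial ℂ)) ^ 4 + (-240893073841556448) * (Polynomial.C Polynomial.X : Polynomial (Polynomial ℂ)) ^ 5) * Polynomial.X ^ 1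
    + ((-13884580985184) * (Polynomial.C Polynomial.X : Polynomial (Polynomial ℂ)) ^ 2 + 22325139938477376 * (Polynomial.C Polynomial.X : Polynomial (Polynomial ℂ)) ^ 3 + (-2770919223917723632) * (Polynomial.C Polynomial.X : Polynomial (Polynomial ℂ)) ^ 4) * Polynomial.X ^ 2
    + ((-2132521530048) * (Polynomial.C Polynomial.X : Polynomial (Polynomial ℂ)) ^ 0 + 448690752199872 * (Polynomial.C Polynomial.X : Polynomial (Polynomial ℂ)) ^ 1 + 40476905637214592 * (Polynomial.C Polynomial.X : Polynomial (Polynomial ℂ)) ^ 2 + (-14155144164491732480) * (Polynomial.C Polynomial.X : Polynomial (Polynomial ℂ)) ^ 3) * Polynomial.X ^ 3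
    + (2476526376340016 * (Polynomial.C Polynomial.X : Polynomial (Polynomial ℂ)) ^ 0 + (-291312562277804704) * (Polynomial.C Polynomial.X : Polynomial (Polynomial ℂ)) ^ 1 + (-24377691863196432176) * (Polynomial.C Polynomial.X : Polynomial (Polynomial ℂ)) ^ 2) * Polynomial.X ^ 4
    + ((-955799817280075040) * (Polynomial.C Polynomial.X : Polynomial (Polynomial ℂ)) ^ 0 + 35198377319680281824 * (Polynomial.C Polynomial.X : Polynomial (Polynomial ℂ)) ^ 1) * Polynomial.X ^ 5
    + (117379609136150973872 * (Polynomial.C Polynomial.X : Polynomial (Polynomial ℂ)) ^ 0) * Polynomial.X ^ 6 := by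
  have h := congrArg psi g25425
  simp only [map_mul, map_add, map_sub, map_pow, map_ofNat, psi_x, psi_y] at h
  rw [h, lx, ly]
  ring

lemma poly_aux (r : Fin 7 → Polynomial ℂ) (F : Polynomial (Polynomial ℂ))
    (h : 25425 * F = ∑ i, Polynomial.C (r i) * Polynomial.X ^ (i : ℕ)) (i : Fin 7) :
    F.coeff i = Polynomial.C (1 / 25425) * r i := by
  have h1 := congrArg (fun P => P.coeff (i : ℕ)) h
  have e : (25425 : Polynomial (Polynomial ℂ)) = Polynomial.C (Polynomial.C 25425) := by
    simp only [map_ofNat]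
  simp only [e, Polynomial.coeff_C_mul, Polynomial.finsetSum_coeff, Polynomial.coeff_X_pow] at h1
  rw [Finset.sum_eq_single i (by intro b _ hb; rw [if_neg (by omega), mul_zero]) (by simp), if_pos rfl, mul_one] at h1
  rw [← h1, ← mul_assoc, ← Polynomial.C_mul]
  norm_num

def gr : Fin 7 → Polynomial ℂ := ![
  Polynomial.C 405579663216 * Polynomial.X ^ 4 + Polynomial.C 84789050542560 * Polynomial.X ^ 5 + Polynomial.C (-7885566899437968) * Polynomial.X ^ 6,
  Polynomial.C 2497201442570016 * Polynomial.X ^ 4 + Polynomial.C (-240893073841556448) * Polynomial.X ^ 5,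
  Polynomial.C (-13884580985184) * Polynomial.X ^ 2 + Polynomial.C 22325139938477376 * Polynomial.X ^ 3 + Polynomial.C (-2770919223917723632) * Polynomial.X ^ 4,
  Polynomial.C (-2132521530048) * Polynomial.X ^ 0 + Polynomial.C 448690752199872 * Polynomial.X ^ 1 + Polynomial.C 40476905637214592 * Polynomial.X ^ 2 + Polynomial.C (-14155144164491732480) * Polynomial.X ^ 3,
  Polynomial.C 2476526376340016 * Polynomial.X ^ 0 + Polynomial.C (-291312562277804704) * Polynomial.X ^ 1 + Polynomial.C (-24377691863196432176) * Polynomial.X ^ 2,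
  Polynomial.C (-955799817280075040) * Polynomial.X ^ 0 + Polynomial.C 35198377319680281824 * Polynomial.X ^ 1,
  Polynomial.C 117379609136150973872 * Polynomial.X ^ 0]

lemma gr_coeff (i : Fin 7) (j : ℕ) : co g i j = (1 / 25425) * (gr i).coeff j := by
  rw [co, poly_aux gr (psi g) _ i, Polynomial.coeff_C_mul]
  rw [psi_g]
  simp only [Fin.sum_univ_seven, gr]
  simp [-map_ofNat]
  simp only [map_ofNat]
  ring

lemma g00 : co g 0 0 = 0 := by
  rw [show (0 : ℕ) = (((0 : Fin 7)) : ℕ) from rfl, gr_coeff]; simp [gr]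
lemma g01 : co g 0 1 = 0 := by
  rw [show (0 : ℕ) = (((0 : Fin 7)) : ℕ) from rfl, gr_coeff]; simp [gr]
lemma g02 : co g 0 2 = 0 := by
  rw [show (0 : ℕ) = (((0 : Fin 7)) : ℕ) from rfl, gr_coeff]; simp [gr]
lemma g03 : co g 0 3 = 0 := by
  rw [show (0 : ℕ) = (((0 : Fin 7)) : ℕ) from rfl, gr_coeff]; simp [gr]
lemma g04 : co g 0 4 = 45064407024/2825 := by
  rw [show (0 : ℕ) = (((0 : Fin 7)) : ℕ) from rfl, gr_coeff]; simp [gr]; try norm_num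
lemma g05 : co g 0 5 = 1884201123168/565 := by
  rw [show (0 : ℕ) = (((0 : Fin 7)) : ℕ) from rfl, gr_coeff]; simp [gr]; try norm_num
lemma g06 : co g 0 6 = -876174099937552/2825 := by
  rw [show (0 : ℕ) = (((0 : Fin 7)) : ℕ) from rfl, gr_coeff]; simp [gr]; try norm_num
lemma g10 : co g 1 0 = 0 := by
  rw [show (1 : ℕ) = (((1 : Fin 7)) : ℕ) from rfl, gr_coeff]; simp [gr]
lemma g11 : co g 1 1 = 0 := by
  rw [show (1 : ℕ) = (((1 : Fin 7)) : ℕ) from rfl, gr_coeff]; simp [gr]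
lemma g12 : co g 1 2 = 0 := by
  rw [show (1 : ℕ) = (((1 : Fin 7)) : ℕ) from rfl, gr_coeff]; simp [gr]
lemma g13 : co g 1 3 = 0 := by
  rw [show (1 : ℕ) = (((1 : Fin 7)) : ℕ) from rfl, gr_coeff]; simp [gr]
lemma g14 : co g 1 4 = 277466826952224/2825 := by
  rw [show (1 : ℕ) = (((1 : Fin 7)) : ℕ) from rfl, gr_coeff]; simp [gr]; try norm_num
lemma g15 : co g 1 5 = -26765897093506272/2825 := by
  rw [show (1 : ℕ) = (((1 : Fin 7)) : ℕ) from rfl, gr_coeff]; simp [gr]; try norm_num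
lemma g20 : co g 2 0 = 0 := by
  rw [show (2 : ℕ) = (((2 : Fin 7)) : ℕ) from rfl, gr_coeff]; simp [gr]
lemma g21 : co g 2 1 = 0 := by
  rw [show (2 : ℕ) = (((2 : Fin 7)) : ℕ) from rfl, gr_coeff]; simp [gr]
lemma g22 : co g 2 2 = -1542731220576/2825 := by
  rw [show (2 : ℕ) = (((2 : Fin 7)) : ℕ) from rfl, gr_coeff]; simp [gr]; try norm_num
lemma g23 : co g 2 3 = 2480571104275264/2825 := by
  rw [show (2 : ℕ) = (((2 : Fin 7)) : ℕ) from rfl, gr_coeff]; simp [gr]; try norm_num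
lemma g24 : co g 2 4 = -2770919223917723632/25425 := by
  rw [show (2 : ℕ) = (((2 : Fin 7)) : ℕ) from rfl, gr_coeff]; simp [gr]; try norm_num
lemma g30 : co g 3 0 = -236946836672/2825 := by
  rw [show (3 : ℕ) = (((3 : Fin 7)) : ℕ) from rfl, gr_coeff]; simp [gr]; try norm_num
lemma g31 : co g 3 1 = 49854528022208/2825 := by
  rw [show (3 : ℕ) = (((3 : Fin 7)) : ℕ) from rfl, gr_coeff]; simp [gr]; try norm_num
lemma g32 : co g 3 2 = 40476905637214592/25425 := by
  rw [show (3 : ℕ) = (((3 : Fin 7)) : ℕ) from rfl, gr_coeff]; simp [gr]; try norm_num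
lemma g33 : co g 3 3 = -2831028832898346496/5085 := by
  rw [show (3 : ℕ) = (((3 : Fin 7)) : ℕ) from rfl, gr_coeff]; simp [gr]; try norm_num
lemma g40 : co g 4 0 = 2476526376340016/25425 := by
  rw [show (4 : ℕ) = (((4 : Fin 7)) : ℕ) from rfl, gr_coeff]; simp [gr]; try norm_num
lemma g41 : co g 4 1 = -291312562277804704/25425 := by
  rw [show (4 : ℕ) = (((4 : Fin 7)) : ℕ) from rfl, gr_coeff]; simp [gr]; try norm_num
lemma g42 : co g 4 2 = -24377691863196432176/25425 := by
  rw [show (4 : ℕ) = (((4 : Fin 7)) : ℕ) from rfl, gr_coeff]; simp [gr]; try norm_num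
lemma g50 : co g 5 0 = -191159963456015008/5085 := by
  rw [show (5 : ℕ) = (((5 : Fin 7)) : ℕ) from rfl, gr_coeff]; simp [gr]; try norm_num
lemma g51 : co g 5 1 = 35198377319680281824/25425 := by
  rw [show (5 : ℕ) = (((5 : Fin 7)) : ℕ) from rfl, gr_coeff]; simp [gr]; try norm_num
lemma g60 : co g 6 0 = 117379609136150973872/25425 := by
  rw [show (6 : ℕ) = (((6 : Fin 7)) : ℕ) from rfl, gr_coeff]; simp [gr]; try norm_num

lemma e6_aux (a b : ℕ → ℕ → ℂ)
    (h20 : a 1 0 * b 1 0 = 0) (h11 : a 1 0 * b 0 1 + a 0 1 * b 1 0 = 0) (h02 : a 0 1 * b 0 1 = 0) :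
    (a 1 0 = 0 ∧ a 0 1 = 0) ∨ (b 1 0 = 0 ∧ b 0 1 = 0) := by
  grind

lemma e6_aux2 (a10 a01 b10 b01 a20 a11 a02 a03 b20 b11 b02 b03 k3 k4 : ℂ) (hk3 : k3 ≠ 0) (hk4 : k4 ≠ 0)
    (z1 : a10 = 0) (z2 : a01 = 0)
    (h30 : a10 * b20 + a20 * b10 = k3)
    (h21 : a10 * b11 + a01 * b20 + a20 * b01 + a11 * b10 = 0)
    (h12 : a10 * b02 + a01 * b11 + a11 * b01 + a02 * b10 = 0)
    (h03 : a01 * b02 + a02 * b01 = 0)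
    (h04 : a01 * b03 + a02 * b02 + a03 * b01 = k4) : False := by
  subst z1 z2
  simp only [zero_mul, zero_add] at *
  have hb : b10 ≠ 0 := by rintro rfl; apply hk3; rw [← h30, mul_zero]
  have ha : a20 ≠ 0 := by rintro rfl; apply hk3; rw [← h30, zero_mul]
  by_cases hb1 : b01 = 0
  · subst hb1
    simp only [mul_zero, add_zero, zero_add, mul_eq_zero, hb, or_false] at h12 h04
    apply hk4; rw [← h04, h12, zero_mul]
  · have e1 : a02 = 0 := by simpa [hb1] using h03
    subst e1
    have e2 : a11 = 0 := by simpa [hb1] using h12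
    subst e2
    have e3 : a20 * b01 = 0 := by simpa using h21
    exact (mul_ne_zero ha hb1) e3

lemma e6_step (a b : ℕ → ℕ → ℂ)
    (hG : ∀ i j, ∑ k ∈ Finset.HasAntidiagonal.antidiagonal i,
      ∑ l ∈ Finset.HasAntidiagonal.antidiagonal j, a k.1 l.1 * b k.2 l.2 = co g i j)
    (za : a 0 0 = 0) (zb : b 0 0 = 0) : False := by
  have h20 := hG 2 0
  have h11 := hG 1 1
  have h02 := hG 0 2
  have h30 := hG 3 0
  have h21 := hG 2 1
  have h12 := hG 1 2
  have h03 := hG 0 3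
  have h04 := hG 0 4
  simp only [Finset.Nat.antidiagonal_succ, Finset.Nat.antidiagonal_zero, Finset.sum_cons, Finset.map_singleton,
    Finset.sum_singleton, Finset.map_cons, Function.Embedding.prodMap, Function.Embedding.coeFn_mk,
    Function.Embedding.refl_apply, Prod.map, Nat.succ_eq_add_one, zero_add, za, zb, mul_zero, zero_mul, add_zero,
    g20, g11, g02, g30, g21, g12, g03, g04, Nat.reduceAdd] at h20 h11 h02 h30 h21 h12 h03 h04
  rcases e6_aux a b (by linear_combination h20) (by linear_combination h11) (by linear_combination h02)
    with ⟨z1, z2⟩ | ⟨z1, z2⟩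
  · exact e6_aux2 _ _ (b 1 0) (b 0 1) (a 2 0) (a 1 1) (a 0 2) (a 0 3) (b 2 0) (b 1 1) (b 0 2) (b 0 3)
      (-236946836672 / 2825) (45064407024 / 2825) (by norm_num) (by norm_num) z1 z2 (by linear_combination h30) (by linear_combination h21)
      (by linear_combination h12) (by linear_combination h03) (by linear_combination h04)
  · exact e6_aux2 _ _ (a 1 0) (a 0 1) (b 2 0) (b 1 1) (b 0 2) (b 0 3) (a 2 0) (a 1 1) (a 0 2) (a 0 3)
      (-236946836672 / 2825) (45064407024 / 2825) (by norm_num) (by norm_num) z1 z2 (by linear_combination h30) (by linear_combination h21)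
      (by linear_combination h12) (by linear_combination h03) (by linear_combination h04)

lemma core (a b : ℕ → ℕ → ℂ)
    (hG : ∀ i j, ∑ k ∈ Finset.HasAntidiagonal.antidiagonal i,
      ∑ l ∈ Finset.HasAntidiagonal.antidiagonal j, a k.1 l.1 * b k.2 l.2 = co g i j)
    (d e : ℕ) (hde : d + e = 6) (he : 1 ≤ e) (ha : ∀ i j, d < i + j → a i j = 0)
    (hb : ∀ i j, e < i + j → b i j = 0) (b00 : b 0 0 = 1) : False := by
  have a00 := hG 0 0
  simp only [Finset.Nat.antidiagonal_succ, Finset.Nat.antidiagonal_zero, Finset.sum_cons, Finset.map_singleton,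
    Finset.sum_singleton, Finset.map_cons, Function.Embedding.prodMap, Function.Embedding.coeFn_mk,
    Function.Embedding.refl_apply, Prod.map, Nat.succ_eq_add_one, zero_add, Nat.reduceAdd, mul_zero, zero_mul, add_zero, mul_one, g00, b00] at a00
  have a10 := hG 1 0
  simp only [Finset.Nat.antidiagonal_succ, Finset.Nat.antidiagonal_zero, Finset.sum_cons, Finset.map_singleton,
    Finset.sum_singleton, Finset.map_cons, Function.Embedding.prodMap, Function.Embedding.coeFn_mk,
    Function.Embedding.refl_apply, Prod.map, Nat.succ_eq_add_one, zero_add, Nat.reduceAdd, mul_zero, zero_mul, add_zero, mul_one, g10, b00, a00] at a10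
  have a01 := hG 0 1
  simp only [Finset.Nat.antidiagonal_succ, Finset.Nat.antidiagonal_zero, Finset.sum_cons, Finset.map_singleton,
    Finset.sum_singleton, Finset.map_cons, Function.Embedding.prodMap, Function.Embedding.coeFn_mk,
    Function.Embedding.refl_apply, Prod.map, Nat.succ_eq_add_one, zero_add, Nat.reduceAdd, mul_zero, zero_mul, add_zero, mul_one, g01, b00, a00, a10] at a01
  have a20 := hG 2 0
  simp only [Finset.Nat.antidiagonal_succ, Finset.Nat.antidiagonal_zero, Finset.sum_cons, Finset.map_singleton,
    Finset.sum_singleton, Finset.map_cons, Function.Embedding.prodMap, Function.Embedding.coeFn_mk,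
    Function.Embedding.refl_apply, Prod.map, Nat.succ_eq_add_one, zero_add, Nat.reduceAdd, mul_zero, zero_mul, add_zero, mul_one, g20, b00, a00, a10, a01] at a20
  have a11 := hG 1 1
  simp only [Finset.Nat.antidiagonal_succ, Finset.Nat.antidiagonal_zero, Finset.sum_cons, Finset.map_singleton,
    Finset.sum_singleton, Finset.map_cons, Function.Embedding.prodMap, Function.Embedding.coeFn_mk,
    Function.Embedding.refl_apply, Prod.map, Nat.succ_eq_add_one, zero_add, Nat.reduceAdd, mul_zero, zero_mul, add_zero, mul_one, g11, b00, a00, a10, a01, a20] at a11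
  have a02 := hG 0 2
  simp only [Finset.Nat.antidiagonal_succ, Finset.Nat.antidiagonal_zero, Finset.sum_cons, Finset.map_singleton,
    Finset.sum_singleton, Finset.map_cons, Function.Embedding.prodMap, Function.Embedding.coeFn_mk,
    Function.Embedding.refl_apply, Prod.map, Nat.succ_eq_add_one, zero_add, Nat.reduceAdd, mul_zero, zero_mul, add_zero, mul_one, g02, b00, a00, a10, a01, a20, a11] at a02
  have a30 := hG 3 0
  simp only [Finset.Nat.antidiagonal_succ, Finset.Nat.antidiagonal_zero, Finset.sum_cons, Finset.map_singleton,
    Finset.sum_singleton, Finset.map_cons, Function.Embedding.prodMap, Function.Embedding.coeFn_mk,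
    Function.Embedding.refl_apply, Prod.map, Nat.succ_eq_add_one, zero_add, Nat.reduceAdd, mul_zero, zero_mul, add_zero, mul_one, g30, b00, a00, a10, a01, a20, a11, a02] at a30
  have a21 := hG 2 1
  simp only [Finset.Nat.antidiagonal_succ, Finset.Nat.antidiagonal_zero, Finset.sum_cons, Finset.map_singleton,
    Finset.sum_singleton, Finset.map_cons, Function.Embedding.prodMap, Function.Embedding.coeFn_mk,
    Function.Embedding.refl_apply, Prod.map, Nat.succ_eq_add_one, zero_add, Nat.reduceAdd, mul_zero, zero_mul, add_zero, mul_one, g21, b00, a00, a10, a01, a20, a11, a02, a30] at a21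
  have a12 := hG 1 2
  simp only [Finset.Nat.antidiagonal_succ, Finset.Nat.antidiagonal_zero, Finset.sum_cons, Finset.map_singleton,
    Finset.sum_singleton, Finset.map_cons, Function.Embedding.prodMap, Function.Embedding.coeFn_mk,
    Function.Embedding.refl_apply, Prod.map, Nat.succ_eq_add_one, zero_add, Nat.reduceAdd, mul_zero, zero_mul, add_zero, mul_one, g12, b00, a00, a10, a01, a20, a11, a02, a30, a21] at a12
  have a03 := hG 0 3
  simp only [Finset.Nat.antidiagonal_succ, Finset.Nat.antidiagonal_zero, Finset.sum_cons, Finset.map_singleton,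
    Finset.sum_singleton, Finset.map_cons, Function.Embedding.prodMap, Function.Embedding.coeFn_mk,
    Function.Embedding.refl_apply, Prod.map, Nat.succ_eq_add_one, zero_add, Nat.reduceAdd, mul_zero, zero_mul, add_zero, mul_one, g03, b00, a00, a10, a01, a20, a11, a02, a30, a21, a12] at a03
  have a04 := hG 0 4
  simp only [Finset.Nat.antidiagonal_succ, Finset.Nat.antidiagonal_zero, Finset.sum_cons, Finset.map_singleton,
    Finset.sum_singleton, Finset.map_cons, Function.Embedding.prodMap, Function.Embedding.coeFn_mk,
    Function.Embedding.refl_apply, Prod.map, Nat.succ_eq_add_one, zero_add, Nat.reduceAdd, mul_zero, zero_mul, add_zero, mul_one, g04, b00, a00, a10, a01, a20, a11, a02, a30, a21, a12, a03] at a04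
  have a13 := hG 1 3
  simp only [Finset.Nat.antidiagonal_succ, Finset.Nat.antidiagonal_zero, Finset.sum_cons, Finset.map_singleton,
    Finset.sum_singleton, Finset.map_cons, Function.Embedding.prodMap, Function.Embedding.coeFn_mk,
    Function.Embedding.refl_apply, Prod.map, Nat.succ_eq_add_one, zero_add, Nat.reduceAdd, mul_zero, zero_mul, add_zero, mul_one, g13, b00, a00, a10, a01, a20, a11, a02, a30, a21, a12, a03, a04] at a13
  have a22 := hG 2 2
  simp only [Finset.Nat.antidiagonal_succ, Finset.Nat.antidiagonal_zero, Finset.sum_cons, Finset.map_singleton,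
    Finset.sum_singleton, Finset.map_cons, Function.Embedding.prodMap, Function.Embedding.coeFn_mk,
    Function.Embedding.refl_apply, Prod.map, Nat.succ_eq_add_one, zero_add, Nat.reduceAdd, mul_zero, zero_mul, add_zero, mul_one, g22, b00, a00, a10, a01, a20, a11, a02, a30, a21, a12, a03, a04, a13] at a22
  have hd : ¬ d < 4 := fun h => by
    rw [ha 0 4 (by omega)] at a04
    norm_num at a04
  have h05 := hG 0 5
  simp only [Finset.Nat.antidiagonal_succ, Finset.Nat.antidiagonal_zero, Finset.sum_cons, Finset.map_singleton,
    Finset.sum_singleton, Finset.map_cons, Function.Embedding.prodMap, Function.Embedding.coeFn_mk,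
    Function.Embedding.refl_apply, Prod.map, Nat.succ_eq_add_one, zero_add, Nat.reduceAdd, mul_zero, zero_mul, add_zero, mul_one, g05, b00, a00, a10, a01, a20, a11, a02, a30, a21, a12, a03, a04, a13, a22] at h05
  have h14 := hG 1 4
  simp only [Finset.Nat.antidiagonal_succ, Finset.Nat.antidiagonal_zero, Finset.sum_cons, Finset.map_singleton,
    Finset.sum_singleton, Finset.map_cons, Function.Embedding.prodMap, Function.Embedding.coeFn_mk,
    Function.Embedding.refl_apply, Prod.map, Nat.succ_eq_add_one, zero_add, Nat.reduceAdd, mul_zero, zero_mul, add_zero, mul_one, g14, b00, a00, a10, a01, a20, a11, a02, a30, a21, a12, a03, a04, a13, a22] at h14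
  have h23 := hG 2 3
  simp only [Finset.Nat.antidiagonal_succ, Finset.Nat.antidiagonal_zero, Finset.sum_cons, Finset.map_singleton,
    Finset.sum_singleton, Finset.map_cons, Function.Embedding.prodMap, Function.Embedding.coeFn_mk,
    Function.Embedding.refl_apply, Prod.map, Nat.succ_eq_add_one, zero_add, Nat.reduceAdd, mul_zero, zero_mul, add_zero, mul_one, g23, b00, a00, a10, a01, a20, a11, a02, a30, a21, a12, a03, a04, a13, a22] at h23
  have h06 := hG 0 6
  simp only [Finset.Nat.antidiagonal_succ, Finset.Nat.antidiagonal_zero, Finset.sum_cons, Finset.map_singleton,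
    Finset.sum_singleton, Finset.map_cons, Function.Embedding.prodMap, Function.Embedding.coeFn_mk,
    Function.Embedding.refl_apply, Prod.map, Nat.succ_eq_add_one, zero_add, Nat.reduceAdd, mul_zero, zero_mul, add_zero, mul_one, g06, b00, a00, a10, a01, a20, a11, a02, a30, a21, a12, a03, a04, a13, a22] at h06
  have h15 := hG 1 5
  simp only [Finset.Nat.antidiagonal_succ, Finset.Nat.antidiagonal_zero, Finset.sum_cons, Finset.map_singleton,
    Finset.sum_singleton, Finset.map_cons, Function.Embedding.prodMap, Function.Embedding.coeFn_mk,
    Function.Embedding.refl_apply, Prod.map, Nat.succ_eq_add_one, zero_add, Nat.reduceAdd, mul_zero, zero_mul, add_zero, mul_one, g15, b00, a00, a10, a01, a20, a11, a02, a30, a21, a12, a03, a04, a13, a22] at h15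
  have h24 := hG 2 4
  simp only [Finset.Nat.antidiagonal_succ, Finset.Nat.antidiagonal_zero, Finset.sum_cons, Finset.map_singleton,
    Finset.sum_singleton, Finset.map_cons, Function.Embedding.prodMap, Function.Embedding.coeFn_mk,
    Function.Embedding.refl_apply, Prod.map, Nat.succ_eq_add_one, zero_add, Nat.reduceAdd, mul_zero, zero_mul, add_zero, mul_one, g24, b00, a00, a10, a01, a20, a11, a02, a30, a21, a12, a03, a04, a13, a22] at h24
  have he2 : e = 1 ∨ e = 2 := by omega
  rcases he2 with rfl | rfl
  · have hd : d = 5 := by omega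
    subst hd
    simp only [ha 0 6 (by norm_num), ha 1 5 (by norm_num), ha 2 4 (by norm_num), hb 0 2 (by norm_num),
      hb 1 1 (by norm_num), hb 2 0 (by norm_num), mul_zero, zero_mul, add_zero, zero_add] at h06 h15 h24 h05 h14 h23
    generalize b 0 1 = v at *
    generalize b 1 0 = u at *
    have e05 : a 0 5 = (45064407024/2825) * ((1418030/6783) - v) := by linear_combination h05
    have e14 : a 1 4 = (45064407024/2825) * ((125291174/20349) - u) := by linear_combination h14
    have e23 : a 2 3 = (45064407024/2825) * ((10080999676/183141) - (-5854/171) * v) := by linear_combination h23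
    rw [e05] at h06 h15
    rw [e14] at h15 h24
    rw [e23] at h24
    have hq : v ^ 2 - (1418030/6783) * v + (-24925298701/1281987) = 0 := by linear_combination -(2825/45064407024) * h06
    have hl : ((1418030/6783) - 2 * v) * u - ((-253811040562/427329) - (125291174/20349) * v) = 0 := by
      linear_combination (2825/45064407024) * h15
    have h6 : ((10080999676/183141) - (-5854/171) * v) * v + ((125291174/20349) - u) * u - (-78826787207491/11537883) = 0 := by
      linear_combination (2825/45064407024) * h24
    have hv : v = (-3988654727911331/56805213454101) := by
      linear_combination (1440871747221879/10887220718202715798765568) * (((1418030/6783) - 2 * v) ^ 2 * h6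
        - 4 * (((10080999676/183141) - (-5854/171) * v) * v - (-78826787207491/11537883)) * hq
        - ((125291174/20349) * ((1418030/6783) - 2 * v) - ((-253811040562/427329) - (125291174/20349) * v) - ((1418030/6783) - 2 * v) * u) * hl
        - (60791793471324236/1445060979) * hq)
    rw [hv] at hq
    norm_num at hq
  · have hd : d = 4 := by omega
    subst hd
    rw [ha 0 5 (by norm_num)] at h05
    rw [ha 2 3 (by norm_num)] at h23
    have hv : b 0 1 = (1418030/6783) := by linear_combination (2825/45064407024) * h05
    rw [hv] at h23
    norm_num at h23

lemma outer_scaled (K P00 P01 P10 P02 P11 P20 Q00 Q01 Q10 Q02 Q11 Q20 Q03 Q12 Q21 Q30 : ℂ) (p00 : P00 = 1) (q00 : Q00 = 1) (hK : K ≠ 0)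
    (h10 : K * ((2 * Q00 * Q10) - (3 * P00 * P00 * P10)) = 0)
    (h01 : K * ((2 * Q00 * Q01) - (3 * P00 * P00 * P01)) = 0)
    (h20 : K * ((2 * Q00 * Q20 + 1 * Q10 * Q10) - (3 * P00 * P00 * P20 + 3 * P00 * P10 * P10)) = 0)
    (h11 : K * ((2 * Q00 * Q11 + 2 * Q01 * Q10) - (3 * P00 * P00 * P11 + 6 * P00 * P01 * P10)) = 0)
    (h02 : K * ((2 * Q00 * Q02 + 1 * Q01 * Q01) - (3 * P00 * P00 * P02 + 3 * P00 * P01 * P01)) = 0)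
    (h30 : K * ((2 * Q00 * Q30 + 2 * Q10 * Q20) - (6 * P00 * P10 * P20 + 1 * P10 * P10 * P10)) = -236946836672/2825)
    (h21 : K * ((2 * Q00 * Q21 + 2 * Q01 * Q20 + 2 * Q10 * Q11) - (6 * P00 * P01 * P20 + 6 * P00 * P10 * P11 + 3 * P01 * P10 * P10)) = 0)
    (h12 : K * ((2 * Q00 * Q12 + 2 * Q01 * Q11 + 2 * Q02 * Q10) - (6 * P00 * P01 * P11 + 6 * P00 * P02 * P10 + 3 * P01 * P01 * P10)) = 0)
    (h03 : K * ((2 * Q00 * Q03 + 2 * Q01 * Q02) - (6 * P00 * P01 * P02 + 1 * P01 * P01 * P01)) = 0)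
    (h04 : K * ((2 * Q01 * Q03 + 1 * Q02 * Q02) - (3 * P00 * P02 * P02 + 3 * P01 * P01 * P02)) = 45064407024/2825)
    (h13 : K * ((2 * Q01 * Q12 + 2 * Q02 * Q11 + 2 * Q03 * Q10) - (6 * P00 * P02 * P11 + 3 * P01 * P01 * P11 + 6 * P01 * P02 * P10)) = 0)
    (h31 : K * ((2 * Q01 * Q30 + 2 * Q10 * Q21 + 2 * Q11 * Q20) - (6 * P00 * P11 * P20 + 6 * P01 * P10 * P20 + 3 * P10 * P10 * P11)) = 49854528022208/2825)
    (h05 : K * ((2 * Q02 * Q03) - (3 * P01 * P02 * P02)) = 1884201123168/565)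
    : False := by
  subst p00 q00
  replace h10 := (mul_eq_zero.mp h10).resolve_left hK
  replace h01 := (mul_eq_zero.mp h01).resolve_left hK
  replace h20 := (mul_eq_zero.mp h20).resolve_left hK
  replace h11 := (mul_eq_zero.mp h11).resolve_left hK
  replace h02 := (mul_eq_zero.mp h02).resolve_left hK
  replace h21 := (mul_eq_zero.mp h21).resolve_left hK
  replace h12 := (mul_eq_zero.mp h12).resolve_left hK
  replace h03 := (mul_eq_zero.mp h03).resolve_left hK
  replace h13 := (mul_eq_zero.mp h13).resolve_left hK
  obtain rfl : Q10 = 3 / 2 * P10 := by linear_combination h10 / 2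
  obtain rfl : Q01 = 3 / 2 * P01 := by linear_combination h01 / 2
  obtain rfl : Q20 = 3 / 2 * P20 + 3 / 8 * P10 ^ 2 := by linear_combination h20 / 2
  obtain rfl : Q11 = 3 / 2 * P11 + 3 / 4 * P10 * P01 := by linear_combination h11 / 2
  obtain rfl : Q02 = 3 / 2 * P02 + 3 / 8 * P01 ^ 2 := by linear_combination h02 / 2
  obtain rfl : Q03 = 3 / 4 * P01 * P02 - P01 ^ 3 / 16 := by linear_combination h03 / 2
  obtain rfl : Q12 = 3 / 4 * (P01 * P11 + P10 * P02) - 3 * P01 ^ 2 * P10 / 16 := by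
    linear_combination h12 / 2
  obtain rfl : Q21 = 3 / 4 * (P10 * P11 + P01 * P20) - 3 * P10 ^ 2 * P01 / 16 := by
    linear_combination h21 / 2
  have hD : P02 - P01 ^ 2 / 4 ≠ 0 := by
    intro h
    have : K * (-(3 / 4) * (P02 - P01 ^ 2 / 4) ^ 2) = (45064407024/2825) := by linear_combination h04
    rw [h] at this
    norm_num at this
  have h13' : (P02 - P01 ^ 2 / 4) * (P11 - P01 * P10 / 2) = 0 := by
    linear_combination -(2 / 3) * h13
  have hD1 := (mul_eq_zero.mp h13').resolve_left hD
  obtain rfl : P11 = P01 * P10 / 2 := by linear_combination hD1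
  have e1 : P01 * (45064407024/2825) = (1884201123168/565) := by linear_combination h05 - P01 * h04
  have e2 : 3 / 2 * P01 * (-236946836672/2825) = (49854528022208/2825) := by linear_combination h31 - 3 / 2 * P01 * h30
  have e3 : P01 = (1418030/6783) := by linear_combination (2825/45064407024) * e1
  rw [e3] at e2
  norm_num at e2

lemma outer (p00 p01 p10 p02 p11 p20 q00 q01 q10 q02 q11 q20 q03 q12 q21 q30 : ℂ) (hp : p00 ≠ 0) (h00 : p00 ^ 3 + q00 ^ 2 = 0)
    (h10 : 3 * p00 * p00 * p10 + (2 * q00 * q10) = 0)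
    (h01 : 3 * p00 * p00 * p01 + (2 * q00 * q01) = 0)
    (h20 : 3 * p00 * p00 * p20 + 3 * p00 * p10 * p10 + (2 * q00 * q20 + 1 * q10 * q10) = 0)
    (h11 : 3 * p00 * p00 * p11 + 6 * p00 * p01 * p10 + (2 * q00 * q11 + 2 * q01 * q10) = 0)
    (h02 : 3 * p00 * p00 * p02 + 3 * p00 * p01 * p01 + (2 * q00 * q02 + 1 * q01 * q01) = 0)
    (h30 : 6 * p00 * p10 * p20 + 1 * p10 * p10 * p10 + (2 * q00 * q30 + 2 * q10 * q20) = -236946836672/2825)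
    (h21 : 6 * p00 * p01 * p20 + 6 * p00 * p10 * p11 + 3 * p01 * p10 * p10 + (2 * q00 * q21 + 2 * q01 * q20 + 2 * q10 * q11) = 0)
    (h12 : 6 * p00 * p01 * p11 + 6 * p00 * p02 * p10 + 3 * p01 * p01 * p10 + (2 * q00 * q12 + 2 * q01 * q11 + 2 * q02 * q10) = 0)
    (h03 : 6 * p00 * p01 * p02 + 1 * p01 * p01 * p01 + (2 * q00 * q03 + 2 * q01 * q02) = 0)
    (h04 : 3 * p00 * p02 * p02 + 3 * p01 * p01 * p02 + (2 * q01 * q03 + 1 * q02 * q02) = 45064407024/2825)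
    (h13 : 6 * p00 * p02 * p11 + 3 * p01 * p01 * p11 + 6 * p01 * p02 * p10 + (2 * q01 * q12 + 2 * q02 * q11 + 2 * q03 * q10) = 0)
    (h31 : 6 * p00 * p11 * p20 + 6 * p01 * p10 * p20 + 3 * p10 * p10 * p11 + (2 * q01 * q30 + 2 * q10 * q21 + 2 * q11 * q20) = 49854528022208/2825)
    (h05 : 3 * p01 * p02 * p02 + (2 * q02 * q03) = 1884201123168/565)
    : False := by
  obtain ⟨s, hs⟩ : ∃ s, s = - q00 / p00 := ⟨_, rfl⟩
  have hs1 : s * p00 = - q00 := by rw [hs]; field_simp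
  have hp0 : p00 = - s ^ 2 := by
    have : p00 ^ 2 * (p00 + s ^ 2) = 0 := by linear_combination h00 + (s * p00 - q00) * hs1
    have := (mul_eq_zero.mp this).resolve_left (pow_ne_zero 2 hp)
    linear_combination this
  have hq0 : q00 = s ^ 3 := by rw [hp0] at hs1; linear_combination hs1
  have hs0 : s ≠ 0 := by rintro rfl; apply hp; rw [hp0]; ring
  obtain ⟨P00, k00⟩ : ∃ P, p00 = - s ^ 2 * P := ⟨- p00 / s ^ 2, by field_simp⟩
  obtain ⟨P01, k01⟩ : ∃ P, p01 = - s ^ 2 * P := ⟨- p01 / s ^ 2, by field_simp⟩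
  obtain ⟨P10, k10⟩ : ∃ P, p10 = - s ^ 2 * P := ⟨- p10 / s ^ 2, by field_simp⟩
  obtain ⟨P02, k02⟩ : ∃ P, p02 = - s ^ 2 * P := ⟨- p02 / s ^ 2, by field_simp⟩
  obtain ⟨P11, k11⟩ : ∃ P, p11 = - s ^ 2 * P := ⟨- p11 / s ^ 2, by field_simp⟩
  obtain ⟨P20, k20⟩ : ∃ P, p20 = - s ^ 2 * P := ⟨- p20 / s ^ 2, by field_simp⟩
  obtain ⟨Q00, l00⟩ : ∃ P, q00 = s ^ 3 * P := ⟨q00 / s ^ 3, by field_simp⟩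
  obtain ⟨Q01, l01⟩ : ∃ P, q01 = s ^ 3 * P := ⟨q01 / s ^ 3, by field_simp⟩
  obtain ⟨Q10, l10⟩ : ∃ P, q10 = s ^ 3 * P := ⟨q10 / s ^ 3, by field_simp⟩
  obtain ⟨Q02, l02⟩ : ∃ P, q02 = s ^ 3 * P := ⟨q02 / s ^ 3, by field_simp⟩
  obtain ⟨Q11, l11⟩ : ∃ P, q11 = s ^ 3 * P := ⟨q11 / s ^ 3, by field_simp⟩
  obtain ⟨Q20, l20⟩ : ∃ P, q20 = s ^ 3 * P := ⟨q20 / s ^ 3, by field_simp⟩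
  obtain ⟨Q03, l03⟩ : ∃ P, q03 = s ^ 3 * P := ⟨q03 / s ^ 3, by field_simp⟩
  obtain ⟨Q12, l12⟩ : ∃ P, q12 = s ^ 3 * P := ⟨q12 / s ^ 3, by field_simp⟩
  obtain ⟨Q21, l21⟩ : ∃ P, q21 = s ^ 3 * P := ⟨q21 / s ^ 3, by field_simp⟩
  obtain ⟨Q30, l30⟩ : ∃ P, q30 = s ^ 3 * P := ⟨q30 / s ^ 3, by field_simp⟩
  have hP : P00 = 1 := by
    apply mul_left_cancel₀ (neg_ne_zero.mpr (pow_ne_zero 2 hs0))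
    rw [← k00, hp0, mul_one]
  have hQ : Q00 = 1 := by
    apply mul_left_cancel₀ (pow_ne_zero 3 hs0)
    rw [← l00, hq0, mul_one]
  clear hp0 hq0 hs1 hs hp h00
  subst k00 k01 k10 k02 k11 k20 l00 l01 l10 l02 l11 l20 l03 l12 l21 l30
  refine outer_scaled (s ^ 6) P00 P01 P10 P02 P11 P20 Q00 Q01 Q10 Q02 Q11 Q20 Q03 Q12 Q21 Q30 hP hQ (pow_ne_zero 6 hs0) ?_ ?_ ?_ ?_ ?_ ?_ ?_ ?_ ?_ ?_ ?_ ?_ ?_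
  · linear_combination h10
  · linear_combination h01
  · linear_combination h20
  · linear_combination h11
  · linear_combination h02
  · linear_combination h30
  · linear_combination h21
  · linear_combination h12
  · linear_combination h03
  · linear_combination h04
  · linear_combination h13
  · linear_combination h31
  · linear_combination h05

lemma inner (p00 p01 p10 p02 p11 p20 q00 q01 q10 q02 q11 q20 q03 q12 q21 q30 : ℂ) (hp : p00 = 0) (hq : q00 = 0)
    (h20 : 3 * p00 * p00 * p20 + 3 * p00 * p10 * p10 + (2 * q00 * q20 + 1 * q10 * q10) = 0)
    (h02 : 3 * p00 * p00 * p02 + 3 * p00 * p01 * p01 + (2 * q00 * q02 + 1 * q01 * q01) = 0)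
    (h30 : 6 * p00 * p10 * p20 + 1 * p10 * p10 * p10 + (2 * q00 * q30 + 2 * q10 * q20) = -236946836672/2825)
    (h03 : 6 * p00 * p01 * p02 + 1 * p01 * p01 * p01 + (2 * q00 * q03 + 2 * q01 * q02) = 0)
    (h04 : 3 * p00 * p02 * p02 + 3 * p01 * p01 * p02 + (2 * q01 * q03 + 1 * q02 * q02) = 45064407024/2825)
    (h13 : 6 * p00 * p02 * p11 + 3 * p01 * p01 * p11 + 6 * p01 * p02 * p10 + (2 * q01 * q12 + 2 * q02 * q11 + 2 * q03 * q10) = 0)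
    (h22 : 6 * p00 * p02 * p20 + 3 * p00 * p11 * p11 + 3 * p01 * p01 * p20 + 6 * p01 * p10 * p11 + 3 * p02 * p10 * p10 + (2 * q01 * q21 + 2 * q02 * q20 + 2 * q10 * q12 + 1 * q11 * q11) = -1542731220576/2825)
    (h31 : 6 * p00 * p11 * p20 + 6 * p01 * p10 * p20 + 3 * p10 * p10 * p11 + (2 * q01 * q30 + 2 * q10 * q21 + 2 * q11 * q20) = 49854528022208/2825)
    (h40 : 3 * p00 * p20 * p20 + 3 * p10 * p10 * p20 + (2 * q10 * q30 + 1 * q20 * q20) = 2476526376340016/25425)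
    (h05 : 3 * p01 * p02 * p02 + (2 * q02 * q03) = 1884201123168/565)
    (h14 : 6 * p01 * p02 * p11 + 3 * p02 * p02 * p10 + (2 * q02 * q12 + 2 * q03 * q11) = 277466826952224/2825)
    (h23 : 6 * p01 * p02 * p20 + 3 * p01 * p11 * p11 + 6 * p02 * p10 * p11 + (2 * q02 * q21 + 2 * q03 * q20 + 2 * q11 * q12) = 2480571104275264/2825)
    (h41 : 3 * p01 * p20 * p20 + 6 * p10 * p11 * p20 + (2 * q11 * q30 + 2 * q20 * q21) = -291312562277804704/25425)
    (h15 : 3 * p02 * p02 * p11 + (2 * q03 * q12) = -26765897093506272/2825)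
    : False := by
  subst hp hq
  obtain rfl : q10 = 0 := by
    have : q10 ^ 2 = 0 := by linear_combination h20
    exact pow_eq_zero_iff (two_ne_zero) |>.mp this
  obtain rfl : q01 = 0 := by
    have : q01 ^ 2 = 0 := by linear_combination h02
    exact pow_eq_zero_iff (two_ne_zero) |>.mp this
  obtain rfl : p01 = 0 := by
    have : p01 ^ 3 = 0 := by linear_combination h03
    exact pow_eq_zero_iff (three_ne_zero) |>.mp this
  have hw : p10 ^ 3 = (-236946836672/2825) := by linear_combination h30
  have he : q02 ^ 2 = (45064407024/2825) := by linear_combination h04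
  have hw0 : p10 ≠ 0 := by rintro rfl; norm_num at hw
  have he0 : q02 ≠ 0 := by rintro rfl; norm_num at he
  obtain rfl : q11 = 0 := by
    have : q02 * q11 = 0 := by linear_combination h13 / 2
    exact (mul_eq_zero.mp this).resolve_left he0
  obtain ⟨A, rfl⟩ : ∃ P, p20 = p10 * P := ⟨p20 / p10, by field_simp⟩
  obtain ⟨B, rfl⟩ : ∃ P, p11 = p10 * P := ⟨p11 / p10, by field_simp⟩
  obtain ⟨C, rfl⟩ : ∃ P, p02 = p10 * P := ⟨p02 / p10, by field_simp⟩
  obtain ⟨h, rfl⟩ : ∃ P, q20 = q02 * P := ⟨q20 / q02, by field_simp⟩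
  obtain ⟨T, rfl⟩ : ∃ P, q21 = q02 * P := ⟨q21 / q02, by field_simp⟩
  obtain ⟨U, rfl⟩ : ∃ P, q12 = q02 * P := ⟨q12 / q02, by field_simp⟩
  obtain ⟨V, rfl⟩ : ∃ P, q03 = q02 * P := ⟨q03 / q02, by field_simp⟩
  obtain rfl : C = ((8781/4046) * h ^ 0 + (513/4046) * h ^ 1) := by
    linear_combination (-2825/710840510016) * (h22 - 2 * h * he - 3 * C * hw)
  obtain rfl : B = (-425647/6069) := by
    linear_combination (-2825/710840510016) * (h31 - 3 * B * hw)
  obtain rfl : A = ((-84576151/218484) * h ^ 0 + (513/8092) * h ^ 2) := by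
    linear_combination (-2825/710840510016) * (h40 - h ^ 2 * he - 3 * A * hw)
  obtain rfl : V = (709015/6783) := by
    linear_combination (2825/90128814048) * (h05 - 2 * V * he)
  obtain rfl : U = ((2155651945/691866) * h ^ 0 + (8781/2023) * h ^ 1 + (513/4046) * h ^ 2) := by
    linear_combination (2825/90128814048) * (h14 - 2 * U * he - 3 * ((8781/4046) * h ^ 0 + (513/4046) * h ^ 1) ^ 2 * hw)
  obtain rfl : T = ((11173326376/444771) * h ^ 0 + (-28227841/115311) * h ^ 1) := by
    linear_combination (2825/90128814048) * (h23 - 2 * (T + h * (709015/6783)) * he - 6 * (-425647/6069) * ((8781/4046) * h ^ 0 + (513/4046) * h ^ 1) * hw)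
  have E1 : ((38490947339376896/48025) * h ^ 1 + (-267616645365888/48025) * h ^ 2 + (-2859463063495805312/1296675) * h ^ 0) = 0 := by
    linear_combination h41 - 2 * h * ((11173326376/444771) * h ^ 0 + (-28227841/115311) * h ^ 1) * he - 6 * (-425647/6069) * ((-84576151/218484) * h ^ 0 + (513/8092) * h ^ 2) * hw
  have E2 : ((1052091934925081534016/52741055) * h ^ 0 + (335705966136837504/13879225) * h ^ 1 + (9806238505192896/13879225) * h ^ 2) = 0 := by
    linear_combination h15 - 2 * (709015/6783) * ((2155651945/691866) * h ^ 0 + (8781/2023) * h ^ 1 + (513/4046) * h ^ 2) * he - 3 * (-425647/6069) * ((8781/4046) * h ^ 0 + (513/4046) * h ^ 1) ^ 2 * hw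
  have hh : h = (-9221961725256656/58987327827987) := by
    linear_combination (39208810625/27487759669859095194652129787904) * ((9806238505192896/13879225) * E1 - (-267616645365888/48025) * E2)
  rw [hh] at E1
  norm_num at E1

lemma torus_core (p q r : ℕ → ℕ → ℂ) (hp : ∀ i j, 2 < i + j → p i j = 0)
    (hq : ∀ i j, 3 < i + j → q i j = 0)
    (hr : ∀ i j, r i j = ∑ k ∈ Finset.HasAntidiagonal.antidiagonal i,
      ∑ l ∈ Finset.HasAntidiagonal.antidiagonal j, p k.1 l.1 * p k.2 l.2)
    (hG : ∀ i j, (∑ k ∈ Finset.HasAntidiagonal.antidiagonal i,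
      ∑ l ∈ Finset.HasAntidiagonal.antidiagonal j, r k.1 l.1 * p k.2 l.2)
      + ∑ k ∈ Finset.HasAntidiagonal.antidiagonal i,
      ∑ l ∈ Finset.HasAntidiagonal.antidiagonal j, q k.1 l.1 * q k.2 l.2 = co g i j) : False := by
  have p03 := hp 0 3 (by norm_num)
  have p12 := hp 1 2 (by norm_num)
  have p21 := hp 2 1 (by norm_num)
  have p30 := hp 3 0 (by norm_num)
  have p04 := hp 0 4 (by norm_num)
  have p13 := hp 1 3 (by norm_num)
  have p22 := hp 2 2 (by norm_num)
  have p31 := hp 3 1 (by norm_num)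
  have p40 := hp 4 0 (by norm_num)
  have p05 := hp 0 5 (by norm_num)
  have p14 := hp 1 4 (by norm_num)
  have p23 := hp 2 3 (by norm_num)
  have p32 := hp 3 2 (by norm_num)
  have p41 := hp 4 1 (by norm_num)
  have p50 := hp 5 0 (by norm_num)
  have q04 := hq 0 4 (by norm_num)
  have q13 := hq 1 3 (by norm_num)
  have q22 := hq 2 2 (by norm_num)
  have q31 := hq 3 1 (by norm_num)
  have q40 := hq 4 0 (by norm_num)
  have q05 := hq 0 5 (by norm_num)
  have q14 := hq 1 4 (by norm_num)
  have q23 := hq 2 3 (by norm_num)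
  have q32 := hq 3 2 (by norm_num)
  have q41 := hq 4 1 (by norm_num)
  have q50 := hq 5 0 (by norm_num)
  have q06 := hq 0 6 (by norm_num)
  have q15 := hq 1 5 (by norm_num)
  have q24 := hq 2 4 (by norm_num)
  have q33 := hq 3 3 (by norm_num)
  have q42 := hq 4 2 (by norm_num)
  have q51 := hq 5 1 (by norm_num)
  have q60 := hq 6 0 (by norm_num)
  have p06 := hp 0 6 (by norm_num)
  have p15 := hp 1 5 (by norm_num)
  have p24 := hp 2 4 (by norm_num)
  have p33 := hp 3 3 (by norm_num)
  have p42 := hp 4 2 (by norm_num)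
  have p51 := hp 5 1 (by norm_num)
  have p60 := hp 6 0 (by norm_num)
  have h00 := hG 0 0
  have h01 := hG 0 1
  have h10 := hG 1 0
  have h02 := hG 0 2
  have h11 := hG 1 1
  have h20 := hG 2 0
  have h03 := hG 0 3
  have h12 := hG 1 2
  have h21 := hG 2 1
  have h30 := hG 3 0
  have h04 := hG 0 4
  have h13 := hG 1 3
  have h22 := hG 2 2
  have h31 := hG 3 1
  have h40 := hG 4 0
  have h05 := hG 0 5
  have h14 := hG 1 4
  have h23 := hG 2 3
  have h41 := hG 4 1
  have h15 := hG 1 5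
  have r00 := hr 0 0
  have r01 := hr 0 1
  have r02 := hr 0 2
  have r03 := hr 0 3
  have r04 := hr 0 4
  have r05 := hr 0 5
  have r10 := hr 1 0
  have r11 := hr 1 1
  have r12 := hr 1 2
  have r13 := hr 1 3
  have r14 := hr 1 4
  have r15 := hr 1 5
  have r20 := hr 2 0
  have r21 := hr 2 1
  have r22 := hr 2 2
  have r23 := hr 2 3
  have r30 := hr 3 0
  have r31 := hr 3 1
  have r40 := hr 4 0
  have r41 := hr 4 1
  simp only [Finset.Nat.antidiagonal_succ, Finset.Nat.antidiagonal_zero, Finset.sum_cons, Finset.map_singleton,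
    Finset.sum_singleton, Finset.map_cons, Function.Embedding.prodMap, Function.Embedding.coeFn_mk,
    Function.Embedding.refl_apply, Prod.map, Nat.succ_eq_add_one, zero_add, Nat.reduceAdd, mul_zero, zero_mul, add_zero, p03, p12, p21, p30, p04, p13, p22, p31, p40, p05, p14, p23, p32, p41, p50, p06, p15, p24, p33, p42, p51, p60] at r00 r01 r02 r03 r04 r05 r10 r11 r12 r13 r14 r15 r20 r21 r22 r23 r30 r31 r40 r41
  simp only [Finset.Nat.antidiagonal_succ, Finset.Nat.antidiagonal_zero, Finset.sum_cons, Finset.map_singleton,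
    Finset.sum_singleton, Finset.map_cons, Function.Embedding.prodMap, Function.Embedding.coeFn_mk,
    Function.Embedding.refl_apply, Prod.map, Nat.succ_eq_add_one, zero_add, Nat.reduceAdd, mul_zero, zero_mul, add_zero, p03, p12, p21, p30, p04, p13, p22, p31, p40, p05, p14, p23, p32, p41, p50, p06, p15, p24, p33, p42, p51, p60, q04, q13, q22, q31, q40, q05, q14, q23, q32, q41, q50, q06, q15, q24, q33, q42, q51, q60, g00, g01, g10, g02, g11, g20, g03, g12, g21, g30, g04, g13, g22, g31, g40, g05, g14, g23, g41, g15, r00, r01, r02, r03, r04, r05, r10, r11, r12, r13, r14, r15, r20, r21, r22, r23, r30, r31, r40, r41] at h00 h01 h10 h02 h11 h20 h03 h12 h21 h30 h04 h13 h22 h31 h40 h05 h14 h23 h41 h15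
  by_cases h : p 0 0 = 0
  · have hq0 : q 0 0 = 0 := by
      have : q 0 0 ^ 2 = 0 := by rw [h] at h00; linear_combination h00
      exact pow_eq_zero_iff (two_ne_zero) |>.mp this
    refine inner (p 0 0) (p 0 1) (p 1 0) (p 0 2) (p 1 1) (p 2 0) (q 0 0) (q 0 1) (q 1 0) (q 0 2) (q 1 1) (q 2 0) (q 0 3) (q 1 2) (q 2 1) (q 3 0) h hq0 ?_ ?_ ?_ ?_ ?_ ?_ ?_ ?_ ?_ ?_ ?_ ?_ ?_ ?_
    · linear_combination h20
    · linear_combination h02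
    · linear_combination h30
    · linear_combination h03
    · linear_combination h04
    · linear_combination h13
    · linear_combination h22
    · linear_combination h31
    · linear_combination h40
    · linear_combination h05
    · linear_combination h14
    · linear_combination h23
    · linear_combination h41
    · linear_combination h15
  · refine outer (p 0 0) (p 0 1) (p 1 0) (p 0 2) (p 1 1) (p 2 0) (q 0 0) (q 0 1) (q 1 0) (q 0 2) (q 1 1) (q 2 0) (q 0 3) (q 1 2) (q 2 1) (q 3 0) h (by linear_combination h00) ?_ ?_ ?_ ?_ ?_ ?_ ?_ ?_ ?_ ?_ ?_ ?_ ?_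
    · linear_combination h10
    · linear_combination h01
    · linear_combination h20
    · linear_combination h11
    · linear_combination h02
    · linear_combination h30
    · linear_combination h21
    · linear_combination h12
    · linear_combination h03
    · linear_combination h04
    · linear_combination h13
    · linear_combination h31
    · linear_combination h05

lemma co_add (A B : MvPolynomial (Fin 2) ℂ) (i j : ℕ) : co (A + B) i j = co A i j + co B i j := by
  simp [co]

lemma torus_part : ¬ ∃ p q : MvPolynomial (Fin 2) ℂ,
        p.totalDegree ≤ 2 ∧ q.totalDegree ≤ 3 ∧ g = p ^ 3 + q ^ 2 := by
  rintro ⟨p, q, hp, hq, h⟩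
  refine torus_core (co p) (co q) (co (p * p)) (fun i j hij => co_deg p i j (by omega))
    (fun i j hij => co_deg q i j (by omega)) (co_mul p p) (fun i j => ?_)
  have h' : g = p * p * p + q * q := by rw [h]; ring
  rw [← co_mul, ← co_mul, ← co_add, ← h']

lemma factor_aux (A B : MvPolynomial (Fin 2) ℂ) (h : g = A * B) (hde : A.totalDegree + B.totalDegree = 6)
    (hB : 1 ≤ B.totalDegree) (h0 : co B 0 0 ≠ 0) : False := by
  refine core (fun i j => co B 0 0 * co A i j) (fun i j => co B i j / co B 0 0) (fun i j => ?_)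
    A.totalDegree B.totalDegree hde hB (fun i j hij => by simp [co_deg A i j hij])
    (fun i j hij => by simp [co_deg B i j hij]) (div_self h0)
  rw [h, co_mul]
  refine Finset.sum_congr rfl fun k _ => Finset.sum_congr rfl fun l _ => ?_
  field_simp

lemma g_ne : g ≠ 0 := by
  intro h
  have := g04
  rw [h] at this
  norm_num [co] at this

lemma y_deg : y.totalDegree = 1 := totalDegree_X _
lemma x_deg : x.totalDegree = 1 := totalDegree_X _

lemma ypow_deg (n : ℕ) : (y ^ n).totalDegree = n := totalDegree_X_pow _ _
lemma xpow_deg (n : ℕ) : (x ^ n).totalDegree = n := totalDegree_X_pow _ _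

lemma g_deg_le : g.totalDegree ≤ 6 := by
  have hc : ∀ q, (c q).totalDegree = 0 := fun q => totalDegree_C _
  have hn : ∀ (n : ℕ) [n.AtLeastTwo],
      (OfNat.ofNat n : MvPolynomial (Fin 2) ℂ).totalDegree = 0 := by
    intro n _
    rw [← map_ofNat (C (σ := Fin 2) (R := ℂ))]
    exact totalDegree_C _
  have hadd : ∀ A B : MvPolynomial (Fin 2) ℂ, A.totalDegree ≤ 6 → B.totalDegree ≤ 6 →
      (A + B).totalDegree ≤ 6 := fun A B h1 h2 => (totalDegree_add A B).trans (max_le h1 h2)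
  have hsub : ∀ A B : MvPolynomial (Fin 2) ℂ, A.totalDegree ≤ 6 → B.totalDegree ≤ 6 →
      (A - B).totalDegree ≤ 6 := fun A B h1 h2 => (totalDegree_sub A B).trans (max_le h1 h2)
  rw [g]
  repeat' first | with_reducible apply hadd | with_reducible apply hsub
  all_goals
    first
    | (rw [ypow_deg])
    | (rw [hc]; norm_num)
    | (refine (totalDegree_mul _ _).trans ?_
       simp only [hc, hn, y_deg, x_deg, xpow_deg, ypow_deg]; norm_num; done)
    | (refine (totalDegree_mul _ _).trans ((add_le_add (totalDegree_mul _ _) le_rfl).trans ?_)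
       simp only [hc, hn, y_deg, x_deg, xpow_deg, ypow_deg]; norm_num; done)

lemma g_deg : g.totalDegree = 6 := by
  refine le_antisymm g_deg_le ?_
  by_contra h
  have := co_deg g 0 6 (by omega)
  rw [g06] at this
  norm_num at this

lemma unit_of_deg (A : MvPolynomial (Fin 2) ℂ) (hA : A ≠ 0) (h : A.totalDegree = 0) : IsUnit A := by
  rw [totalDegree_eq_zero_iff_eq_C] at h
  rw [h] at hA ⊢
  refine IsUnit.map C (isUnit_iff_ne_zero.mpr ?_)
  intro h0
  rw [h0, map_zero] at hA
  exact hA rfl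

lemma irr_part : Irreducible g := by
  refine ⟨fun hu => ?_, fun A B h => ?_⟩
  · obtain ⟨r, hr, h⟩ := MvPolynomial.isUnit_iff_eq_C_of_isReduced.mp hu
    have := g_deg
    rw [h, totalDegree_C] at this
    omega
  · by_contra hAB
    rw [not_or] at hAB
    have hA : A ≠ 0 := by rintro rfl; exact g_ne (by rw [h, zero_mul])
    have hB : B ≠ 0 := by rintro rfl; exact g_ne (by rw [h, mul_zero])
    have hA1 : 1 ≤ A.totalDegree :=
      Nat.one_le_iff_ne_zero.mpr fun h0 => hAB.1 (unit_of_deg A hA h0)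
    have hB1 : 1 ≤ B.totalDegree :=
      Nat.one_le_iff_ne_zero.mpr fun h0 => hAB.2 (unit_of_deg B hB h0)
    have hd : A.totalDegree + B.totalDegree = 6 := by
      rw [← totalDegree_mul_of_isDomain hA hB, ← h, g_deg]
    by_cases hb : co B 0 0 = 0
    · by_cases ha : co A 0 0 = 0
      · exact e6_step (co A) (co B) (fun i j => by rw [h, co_mul]) ha hb
      · exact factor_aux B A (by rw [h, mul_comm]) (by omega) hA1 ha
    · exact factor_aux A B h hd hB1 hb

/-- `g` is irreducible and of non-torus type. -/
theorem g_irreducible_and_non_torus :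
    Irreducible g ∧
      ¬ ∃ p q : MvPolynomial (Fin 2) ℂ,
        p.totalDegree ≤ 2 ∧ q.totalDegree ≤ 3 ∧ g = p ^ 3 + q ^ 2 :=
  ⟨irr_part, torus_part⟩

end
end

section
/- In ℂ[x,y], let s = √30 (the positive real square root of 30), and define f2 = -(9/4)y^2 + (19/4)x^2 + x + 13/4, g4 = -(105/32)y^4 - (199/16)x^4 - 8x^3 + (165/16)y^2 - (21/4)x - (1/24)x^3 s - (661/32)x^2 + (1/12)x^2 s + (405/32)x^2 y^2 + (15/4)x y^2 - (1/24)x^4 s - 257/32, and h2 = (15/4)y^2 - 19/4 - (813/16)x^2 - 2(-661/32 + (1/12)s)x^2 - 2x. Let f = f2^5 + g4^2 * h2, a polynomial of degree 10. Then there do not exist polynomials p, q ∈ ℂ[x,y] with total degree of p at most 2 and total degree of q at most 5 such that f = p^5 + q^2. -/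
open MvPolynomial

noncomputable section

/-- `s = √30`, as a constant polynomial. -/
def s : MvPolynomial (Fin 2) ℂ := C ((Real.sqrt 30 : ℝ) : ℂ)

def f2 : MvPolynomial (Fin 2) ℂ :=
  - c (9/4) * y ^ 2 + c (19/4) * x ^ 2 + x + c (13/4)

def g4 : MvPolynomial (Fin 2) ℂ :=
  - c (105/32) * y ^ 4 - c (199/16) * x ^ 4 - 8 * x ^ 3 + c (165/16) * y ^ 2
    - c (21/4) * x - c (1/24) * x ^ 3 * s - c (661/32) * x ^ 2 + c (1/12) * x ^ 2 * s
    + c (405/32) * x ^ 2 * y ^ 2 + c (15/4) * x * y ^ 2 - c (1/24) * x ^ 4 * s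
    - c (257/32)

def h2 : MvPolynomial (Fin 2) ℂ :=
  c (15/4) * y ^ 2 - c (19/4) - c (813/16) * x ^ 2
    - 2 * (- c (661/32) + c (1/12) * s) * x ^ 2 - 2 * x

/-- The degree-10 curve of semi-torus type with ten `A_4` singularities. -/
def f : MvPolynomial (Fin 2) ℂ := f2 ^ 5 + g4 ^ 2 * h2

/-- Elements `a + b√30` with `a² ≠ 30 b²` do not vanish. -/
theorem quad_ne (S : ℂ) (hS : S ^ 2 = 30) (a b : ℂ) (h : a ^ 2 - 30 * b ^ 2 ≠ 0) :
    a + b * S ≠ 0 := by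
  intro h0
  apply h
  linear_combination (a - b * S) * h0 + b ^ 2 * hS

/-- evaluation of the three polynomials -/
theorem ev_f2 (a b : ℂ) : eval ![a, b] f2 = -(9/4) * b ^ 2 + 19/4 * a ^ 2 + a + 13/4 := by
  simp [f2, x, y, c]

theorem ev_g4 (a b : ℂ) : eval ![a, b] g4 =
    - (105/32) * b ^ 4 - (199/16) * a ^ 4 - 8 * a ^ 3 + (165/16) * b ^ 2
    - (21/4) * a - (1/24) * a ^ 3 * ((Real.sqrt 30 : ℝ) : ℂ) - (661/32) * a ^ 2
    + (1/12) * a ^ 2 * ((Real.sqrt 30 : ℝ) : ℂ)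
    + (405/32) * a ^ 2 * b ^ 2 + (15/4) * a * b ^ 2
    - (1/24) * a ^ 4 * ((Real.sqrt 30 : ℝ) : ℂ) - (257/32) := by
  have h8 : (8 : MvPolynomial (Fin 2) ℂ) = C 8 := (map_ofNat C 8).symm
  simp [g4, x, y, c, s, h8]

theorem ev_h2 (a b : ℂ) : eval ![a, b] h2 =
    15/4 * b ^ 2 - 19/4 - (57 + ((Real.sqrt 30 : ℝ) : ℂ)) / 6 * a ^ 2 - 2 * a := by
  have h8 : (2 : MvPolynomial (Fin 2) ℂ) = C 2 := (map_ofNat C 2).symm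
  simp [h2, x, y, c, s, h8]
  ring

theorem pd_h2 (a b : ℂ) : eval ![a, b] (pderiv 1 h2) = 15/2 * b := by
  have h8 : (2 : MvPolynomial (Fin 2) ℂ) = C 2 := (map_ofNat C 2).symm
  simp [h2, x, y, c, s, h8, pderiv_X, Derivation.leibniz, Derivation.leibniz_pow]
  ring

theorem sqrt_sq30 : ((Real.sqrt 30 : ℝ) : ℂ) ^ 2 = 30 := by
  rw [← Complex.ofReal_pow, Real.sq_sqrt (by norm_num)]
  norm_num

/-- At the points `f2 = h2 = 0` neither `y` nor `g4` vanish. -/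
theorem point_ne (S a b : ℂ) (hS : S ^ 2 = 30)
    (h1 : -(9/4) * b ^ 2 + 19/4 * a ^ 2 + a + 13/4 = 0)
    (h2 : 15/4 * b ^ 2 - 19/4 - (57 + S) / 6 * a ^ 2 - 2 * a = 0) :
    b ≠ 0 ∧ - (105/32) * b ^ 4 - (199/16) * a ^ 4 - 8 * a ^ 3 + (165/16) * b ^ 2
    - (21/4) * a - (1/24) * a ^ 3 * S - (661/32) * a ^ 2
    + (1/12) * a ^ 2 * S
    + (405/32) * a ^ 2 * b ^ 2 + (15/4) * a * b ^ 2
    - (1/24) * a ^ 4 * S - (257/32) ≠ 0 := by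
  have hq : (19 + 2 * S) * a ^ 2 + 4 * a - 8 = 0 := by
    linear_combination (-20) * h1 + (-12) * h2
  have ha2 : a ^ 2 = (152/241 - 16/241 * S) + (-76/241 + 8/241 * S) * a := by
    linear_combination ((19 - 2 * S) / 241) * hq + 4/241 * a ^ 2 * hS
  have hb2 : b ^ 2 = (669/241 - 304/2169 * S) + (-160/723 + 152/2169 * S) * a := by
    linear_combination (-4/9) * h1 + 19/9 * ha2
  have key : ∀ u v : ℂ, u + v * a = 0 → (19 + 2 * S) * u ^ 2 - 4 * u * v - 8 * v ^ 2 = 0 := by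
    intro u v huv
    linear_combination v ^ 2 * hq + ((19 + 2 * S) * (u - v * a) - 4 * v) * huv
  constructor
  · rintro rfl
    have h0 := key (669/241 - 304/2169 * S) (-160/723 + 152/2169 * S) (by rw [← hb2]; ring)
    refine quad_ne S hS (735193/6507) (2498/2169) (by norm_num) ?_
    ring_nf at h0 ⊢
    have hS3 : S ^ 3 = 30 * S := by rw [pow_succ, hS]
    rw [hS3, hS] at h0
    linear_combination h0
  · intro hg
    have ha3 : a ^ 3 = ((152/241 - 16/241 * S) + (-76/241 + 8/241 * S) * a) * a := by
      rw [← ha2]; ring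
    have ha4 : a ^ 4 = ((152/241 - 16/241 * S) + (-76/241 + 8/241 * S) * a) ^ 2 := by
      rw [← ha2]; ring
    have hb4 : b ^ 4 = ((669/241 - 304/2169 * S) + (-160/723 + 152/2169 * S) * a) ^ 2 := by
      rw [← hb2]; ring
    have hS3 : S ^ 3 = 30 * S := by rw [pow_succ, hS]
    have hS4 : S ^ 4 = 900 := by
      have : S ^ 4 = (S ^ 2) ^ 2 := by ring
      rw [this, hS]; norm_num
    have hlin : (3502185/27995042 + 279980/13997521 * S)
        + (27316025/125977689 + 163195/125977689 * S) * a = 0 := by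
      rw [hb4, ha4, ha3, hb2, ha2] at hg
      ring_nf at hg
      rw [ha2] at hg
      ring_nf at hg
      rw [hS4, hS3, hS] at hg
      linear_combination hg
    have h0 := key _ _ hlin
    refine quad_ne S hS (1530749275/4535196804) (290026925/2267598402) (by norm_num) ?_
    ring_nf at h0
    rw [hS3, hS] at h0
    linear_combination h0

/-- homogenised pull-back of a polynomial of degree `≤ d` -/
theorem pullback (N M D : Polynomial ℂ) (p : MvPolynomial (Fin 2) ℂ) (d : ℕ)
    (hd : p.totalDegree ≤ d) :
    ∃ v : Polynomial ℂ, ∀ t : ℂ, D.eval t ≠ 0 →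
      v.eval t = D.eval t ^ d * eval ![N.eval t / D.eval t, M.eval t / D.eval t] p := by
  refine ⟨∑ m ∈ p.support, Polynomial.C (coeff m p) * N ^ (m 0) * M ^ (m 1)
    * D ^ (d - (m 0 + m 1)), ?_⟩
  intro t ht
  rw [Polynomial.eval_finsetSum, MvPolynomial.eval_eq', Finset.mul_sum]
  refine Finset.sum_congr rfl fun m hm => ?_
  have hle : m 0 + m 1 ≤ d := by
    have := (MvPolynomial.le_totalDegree hm).trans hd
    rw [Finsupp.sum_fintype _ _ (by simp)] at this
    simpa using this
  obtain ⟨e, rfl⟩ := Nat.exists_eq_add_of_le hle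
  simp only [Polynomial.eval_mul, Polynomial.eval_pow, Polynomial.eval_C, Fin.prod_univ_two,
    Matrix.cons_val_zero, Matrix.cons_val_one, Nat.add_sub_cancel_left, div_pow, pow_add]
  field_simp

/-- a curve `p^5+q^2` is not smooth at a common zero with `p`. -/
theorem no_common (p q : MvPolynomial (Fin 2) ℂ) (h : f = p ^ 5 + q ^ 2) (a b : ℂ)
    (hf : eval ![a, b] f2 = 0) (hh : eval ![a, b] h2 = 0) (hp : eval ![a, b] p = 0) : False := by
  have hq : eval ![a, b] q = 0 := by
    have := congrArg (eval ![a, b]) h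
    simpa [f, hf, hh, hp] using this.symm
  have h1 := congrArg (fun z => eval ![a, b] (pderiv 1 z)) h
  simp [f, Derivation.leibniz, Derivation.leibniz_pow, hf, hh, hp, hq, pd_h2] at h1
  rw [ev_f2] at hf
  rw [ev_h2] at hh
  obtain ⟨h2, h3⟩ := point_ne _ a b sqrt_sq30 hf hh
  rw [← ev_g4] at h3
  simp_all

/-- the univariate Fermat-Catalan input -/
theorem common_root (u v w : Polynomial ℂ) (hu : u.natDegree ≠ 0) (h : u ^ 5 = v ^ 5 + w ^ 2) :
    ∃ t, u.eval t = 0 ∧ v.eval t = 0 := by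
  by_contra hcon
  push Not at hcon
  have hu0 : u ≠ 0 := by rintro rfl; simp at hu
  have huu : ¬ IsUnit u := fun hh => hu (Polynomial.natDegree_eq_zero_of_isUnit hh)
  have hco : IsCoprime u v := by
    rw [Polynomial.isCoprime_iff_aeval_ne_zero_of_isAlgClosed ℂ ℂ]
    intro t
    by_cases ht : u.eval t = 0
    · right; simpa using hcon t ht
    · left; simpa using ht
  have hv0 : v ≠ 0 := by
    rintro rfl
    exact huu (isCoprime_zero_right.mp hco)
  have hw0 : w ≠ 0 := by
    rintro rfl
    have h5 : IsCoprime (u ^ 5) (v ^ 5) := hco.pow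
    have : v ^ 5 = u ^ 5 := by rw [h]; ring
    rw [this, isCoprime_self] at h5
    exact huu (isUnit_pow_iff (by norm_num) |>.mp h5)
  have := Polynomial.flt_catalan (p := 5) (q := 5) (r := 2) (by norm_num) (by norm_num)
    (by norm_num) (by norm_num) (by norm_num) (by norm_num) (by norm_num) hu0 hv0 hw0 hco
    (u := 1) (v := -1) (w := -1) (by norm_num) (by norm_num) (by norm_num)
    (by simp [h])
  exact hu this.1

/-- `f` is not of `(5,2)`-torus type. -/
theorem f_non_torus :
    ¬ ∃ p q : MvPolynomial (Fin 2) ℂ,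
      p.totalDegree ≤ 2 ∧ q.totalDegree ≤ 5 ∧ f = p ^ 5 + q ^ 2 := by
  rintro ⟨p, q, hp, hq, h⟩
  set S : ℂ := ((Real.sqrt 30 : ℝ) : ℂ) with hSdef
  have hS : S ^ 2 = 30 := sqrt_sq30
  set k : ℂ := (57 + S) / 6 with hk
  have hk0 : k ≠ 0 := by
    have := quad_ne S hS (57/6) (1/6) (by norm_num)
    intro h0; apply this; rw [← h0, hk]; ring
  obtain ⟨r, hr⟩ : ∃ r : ℂ, r ^ 2 = 1 - 19/4 * k := IsAlgClosed.exists_pow_nat_eq _ (by norm_num)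
  obtain ⟨x0, hx0⟩ : ∃ x0 : ℂ, k * x0 ^ 2 + 2 * x0 + 19/4 = 0 := by
    refine ⟨(r - 1) / k, ?_⟩
    field_simp
    linear_combination 4 * hr
  have hA : (19 + 2 * S) ≠ 0 := by
    have := quad_ne S hS 19 2 (by norm_num)
    rwa [mul_comm] at this ⊢
  let N : Polynomial ℂ := Polynomial.C (15/4 * x0) * Polynomial.X ^ 2 + Polynomial.C (k * x0 + 2)
  let M : Polynomial ℂ := Polynomial.C (2 * k * x0 + 2) * Polynomial.X
  let D : Polynomial ℂ := Polynomial.C (15/4) * Polynomial.X ^ 2 - Polynomial.C k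
  let u : Polynomial ℂ := Polynomial.C (-1/20) * (Polynomial.C (19 + 2 * S) * N ^ 2
    + 4 * N * D - 8 * D ^ 2)
  have hN : ∀ t, N.eval t = 15/4 * x0 * t ^ 2 + (k * x0 + 2) := by intro t; simp [N]
  have hM : ∀ t, M.eval t = (2 * k * x0 + 2) * t := by intro t; simp [M]
  have hD : ∀ t, D.eval t = 15/4 * t ^ 2 - k := by intro t; simp [D]
  have hu : ∀ t, u.eval t = -1/20 * ((19 + 2 * S) * N.eval t ^ 2
    + 4 * N.eval t * D.eval t - 8 * D.eval t ^ 2) := by intro t; simp [u]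
  have hconic : ∀ t, 15/4 * M.eval t ^ 2 - 19/4 * D.eval t ^ 2 - k * N.eval t ^ 2
      - 2 * N.eval t * D.eval t = 0 := by
    intro t
    rw [hN, hM, hD]
    linear_combination (-(225/16) * t ^ 4 + 15/2 * k * t ^ 2 - k ^ 2) * hx0
  have hk1 : k * x0 + 1 ≠ 0 := by
    intro h1
    have hx : x0 = -19/4 := by linear_combination hx0 - x0 * h1
    rw [hx, hk] at h1
    refine quad_ne S hS (-(19 * 57)/24 + 1) (-19/24) (by norm_num) ?_
    linear_combination h1
  have hDu : ∀ t, u.eval t = 0 → D.eval t ≠ 0 := by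
    intro t h1 h2
    rw [hu, h2] at h1
    have h3 : N.eval t = 0 := by
      have : (19 + 2 * S) * N.eval t ^ 2 = 0 := by linear_combination -20 * h1
      simpa [hA] using this
    apply hk1
    rw [hN] at h3
    rw [hD] at h2
    linear_combination 1/2 * h3 - 1/2 * x0 * h2
  have evh : ∀ t, D.eval t ≠ 0 → eval ![N.eval t / D.eval t, M.eval t / D.eval t] h2 = 0 := by
    intro t ht
    rw [ev_h2, ← hSdef, ← hk]
    field_simp
    linear_combination 4 * hconic t
  have evf : ∀ t, D.eval t ≠ 0 →
      u.eval t = D.eval t ^ 2 * eval ![N.eval t / D.eval t, M.eval t / D.eval t] f2 := by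
    intro t ht
    have h1 := evh t ht
    rw [ev_h2, ← hSdef] at h1
    have h3 : eval ![N.eval t / D.eval t, M.eval t / D.eval t] f2 =
        -1/20 * ((19 + 2 * S) * (N.eval t / D.eval t) ^ 2 + 4 * (N.eval t / D.eval t) - 8) := by
      rw [ev_f2]
      linear_combination (-3/5) * h1
    rw [h3, hu]
    field_simp
  have hudeg : u.natDegree ≠ 0 := by
    intro h0
    obtain ⟨a, ha⟩ := Polynomial.natDegree_eq_zero.mp h0
    have e : ∀ t, u.eval t = a := by intro t; rw [← ha]; simp
    have e0 := e 0
    have e1 := e 1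
    have e2 := e 2
    rw [hu, hN, hD] at e0 e1 e2
    have h4 : (19 + 2 * S) * x0 ^ 2 + 4 * x0 - 8 = 0 := by
      linear_combination (-20) * (16/225) * (1/12) * (e2 - 4 * e1 + 3 * e0)
    refine (point_ne S x0 0 hS ?_ ?_).1 rfl
    · linear_combination (-1/20) * h4 + (3/5) * hx0
    · linear_combination -hx0
  obtain ⟨v, hv⟩ := pullback N M D p 2 hp
  obtain ⟨w, hw⟩ := pullback N M D q 5 hq
  have hD0 : D ≠ 0 := by
    intro h0
    have h1 := hD 0
    rw [h0] at h1
    apply hk0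
    simpa using h1
  have hid : u ^ 5 = v ^ 5 + w ^ 2 := by
    have : D * (u ^ 5 - (v ^ 5 + w ^ 2)) = 0 := by
      apply Polynomial.funext
      intro t
      by_cases ht : D.eval t = 0
      · simp [ht]
      · have h1 := congrArg (eval ![N.eval t / D.eval t, M.eval t / D.eval t]) h
        simp only [f, map_add, map_mul, map_pow, evh t ht] at h1
        simp only [Polynomial.eval_mul, Polynomial.eval_sub, Polynomial.eval_add,
          Polynomial.eval_pow, evf t ht, hv t ht, hw t ht, Polynomial.eval_zero]
        linear_combination D.eval t ^ 11 * h1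
    rcases mul_eq_zero.mp this with h1 | h1
    · exact absurd h1 hD0
    · exact sub_eq_zero.mp h1
  obtain ⟨t, ht1, ht2⟩ := common_root u v w hudeg hid
  have ht := hDu t ht1
  refine no_common p q h _ _ ?_ (evh t ht) ?_
  · have := evf t ht
    rw [ht1] at this
    simpa [ht] using this.symm
  · have := hv t ht
    rw [ht2] at this
    simpa [ht] using this.symm

end
end
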